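/- arXiv:math/0405033 — 2 statements merged into one kernel-verified Lean document; each statement's English description precedes it below -/
import Mathlib

section
/- For every integer n ≥ 2, among all vectors a = (a₀, a₁, …, a_n) ∈ ℝ^{n+1} satisfying the two linear constraints a₀ + 2·Σ_{j=1}^{n} a_j = 1 and Σ_{j=1}^{n} j² a_j = −1/3, the function ν(a) = |a₀| + 2·Σ_{j=1}^{n} |a_j| attains its minimum at the unique point a* given by a₀* = 1 + 2/(3n²), a_n* = −1/(3n²), and a_j* = 0 for 1 ≤ j ≤ n−1; the minimal value is ν(a*) = 1 + 4/(3n²). -/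
open Finset

/-- The ℓ¹-type functional `ν(a) = |a₀| + 2 Σ_{j=1}^n |a_j|` bounding the
infinite norm of the symmetric discrete quasi-interpolant. -/
noncomputable def nuNorm (n : ℕ) (a : Fin (n + 1) → ℝ) : ℝ :=
  |a 0| + 2 * ∑ j ∈ Finset.univ.erase (0 : Fin (n + 1)), |a j|

/-- The optimal coefficient vector for the near-best cubic spline integral
quasi-interpolant: `a₀* = 1 + 2/(3n²)`, `a_n* = −1/(3n²)`, `a_j* = 0`
for `1 ≤ j ≤ n−1`. -/
noncomputable def aStarI (n : ℕ) : Fin (n + 1) → ℝ := fun j =>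
  if j = 0 then 1 + 2 / (3 * (n : ℝ) ^ 2)
  else if (j : ℕ) = n then -(1 / (3 * (n : ℝ) ^ 2)) else 0

/-- A sum over the nonzero indices whose terms vanish except at the last index. -/
lemma sum_erase_zero_eq_last {n : ℕ} (hn : n ≠ 0) (f : Fin (n + 1) → ℝ)
    (hf : ∀ j : Fin (n + 1), j ≠ 0 → (j : ℕ) ≠ n → f j = 0) :
    ∑ j ∈ Finset.univ.erase (0 : Fin (n + 1)), f j = f (Fin.last n) := by
  refine Finset.sum_eq_single_of_mem _ ?_ fun j hj hjn => hf j (Finset.ne_of_mem_erase hj) ?_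
  · simpa [Fin.ext_iff] using hn
  · exact fun h => hjn (Fin.ext h)

/-- The slack `|x| - x + 2 t x` is nonnegative for `0 ≤ t ≤ 1`. -/
lemma abs_slack_nonneg {t : ℝ} (ht : 0 ≤ t) (ht1 : t ≤ 1) (x : ℝ) :
    0 ≤ |x| - x + 2 * (t * x) := by
  rcases abs_cases x with ⟨h, hx⟩ | ⟨h, hx⟩ <;> rw [h] <;> nlinarith

/-- The slack `|x| - x + 2 t x` vanishes only at `x = 0` when `0 < t < 1`. -/
lemma eq_zero_of_abs_slack_eq_zero {t x : ℝ} (ht : 0 < t) (ht1 : t < 1)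
    (h : |x| - x + 2 * (t * x) = 0) : x = 0 := by
  rcases lt_trichotomy x 0 with hx | hx | hx
  · rw [abs_of_neg hx] at h
    nlinarith
  · exact hx
  · rw [abs_of_pos hx] at h
    nlinarith

/-- On the constraint set, `nuNorm` exceeds the optimal value by a sum of slacks. -/
lemma nuNorm_eq_add_slack {n : ℕ} {a : Fin (n + 1) → ℝ}
    (h1 : a 0 + 2 * ∑ j ∈ Finset.univ.erase (0 : Fin (n + 1)), a j = 1)
    (h2 : ∑ j ∈ Finset.univ.erase (0 : Fin (n + 1)), ((j : ℕ) : ℝ) ^ 2 * a j = -(1 / 3 : ℝ)) :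
    nuNorm n a = 1 + 4 / (3 * (n : ℝ) ^ 2) + (|a 0| - a 0) +
      2 * ∑ j ∈ Finset.univ.erase (0 : Fin (n + 1)),
        (|a j| - a j + 2 * (((j : ℕ) : ℝ) ^ 2 / (n : ℝ) ^ 2 * a j)) := by
  have h3 : ∑ j ∈ Finset.univ.erase (0 : Fin (n + 1)), ((j : ℕ) : ℝ) ^ 2 / (n : ℝ) ^ 2 * a j =
      -(1 / 3) / (n : ℝ) ^ 2 := by
    rw [← h2, Finset.sum_div]
    exact Finset.sum_congr rfl fun j _ => by ring
  rw [Finset.sum_add_distrib, Finset.sum_sub_distrib, ← Finset.mul_sum, h3, nuNorm]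
  linear_combination h1

/-- **Near-best integral cubic spline quasi-interpolants.**  For `n ≥ 2`,
among all `a = (a₀,…,a_n)` with `a₀ + 2 Σ_{j=1}^n a_j = 1` and
`Σ_{j=1}^n j² a_j = −1/3`, the functional `ν(a) = |a₀| + 2 Σ_{j=1}^n |a_j|`
attains its minimum exactly at `a*`, with minimal value `ν(a*) = 1 + 4/(3n²)`. -/
theorem near_best_integral_cubic_QI (n : ℕ) (hn : 2 ≤ n) :
    (aStarI n 0 + 2 * ∑ j ∈ Finset.univ.erase (0 : Fin (n + 1)), aStarI n j = 1) ∧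
    (∑ j ∈ Finset.univ.erase (0 : Fin (n + 1)),
        ((j : ℕ) : ℝ) ^ 2 * aStarI n j = -(1 / 3 : ℝ)) ∧
    nuNorm n (aStarI n) = 1 + 4 / (3 * (n : ℝ) ^ 2) ∧
    ∀ a : Fin (n + 1) → ℝ,
      (a 0 + 2 * ∑ j ∈ Finset.univ.erase (0 : Fin (n + 1)), a j = 1) →
      (∑ j ∈ Finset.univ.erase (0 : Fin (n + 1)), ((j : ℕ) : ℝ) ^ 2 * a j = -(1 / 3 : ℝ)) →
      nuNorm n (aStarI n) ≤ nuNorm n a ∧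
        (nuNorm n a = nuNorm n (aStarI n) → a = aStarI n) := by
  have hn0 : n ≠ 0 := by omega
  have hnR : (0 : ℝ) < n := by positivity
  have hlast : Fin.last n ≠ 0 := by simpa [Fin.ext_iff] using hn0
  have hs0 : aStarI n 0 = 1 + 2 / (3 * (n : ℝ) ^ 2) := by simp [aStarI]
  have hsn : aStarI n (Fin.last n) = -(1 / (3 * (n : ℝ) ^ 2)) := by
    rw [aStarI, if_neg hlast, if_pos (Fin.val_last n)]
  have hsj : ∀ j : Fin (n + 1), j ≠ 0 → (j : ℕ) ≠ n → aStarI n j = 0 := fun j h0 h => by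
    rw [aStarI, if_neg h0, if_neg h]
  have hval : nuNorm n (aStarI n) = 1 + 4 / (3 * (n : ℝ) ^ 2) := by
    rw [nuNorm, sum_erase_zero_eq_last hn0 _ fun j h0 h => by rw [hsj j h0 h, abs_zero],
      hs0, hsn, abs_neg, abs_of_nonneg (by positivity), abs_of_nonneg (by positivity)]
    ring
  refine ⟨?_, ?_, hval, fun a h1 h2 => ?_⟩
  · rw [sum_erase_zero_eq_last hn0 _ hsj, hs0, hsn]
    ring
  · rw [sum_erase_zero_eq_last hn0 _ fun j h0 h => by rw [hsj j h0 h, mul_zero], hsn,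
      Fin.val_last]
    field_simp
  have hslack : ∀ j ∈ Finset.univ.erase (0 : Fin (n + 1)),
      0 ≤ |a j| - a j + 2 * (((j : ℕ) : ℝ) ^ 2 / (n : ℝ) ^ 2 * a j) := fun j _ => by
    refine abs_slack_nonneg (by positivity) (div_le_one_of_le₀ ?_ (by positivity)) _
    gcongr
    exact Fin.is_le j
  have hsum := Finset.sum_nonneg hslack
  have hnu := nuNorm_eq_add_slack h1 h2
  have ha0 := le_abs_self (a 0)
  refine ⟨by linarith, fun heq => ?_⟩
  have hzero := (Finset.sum_eq_zero_iff_of_nonneg hslack).1 (by linarith)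
  have haj : ∀ j : Fin (n + 1), j ≠ 0 → (j : ℕ) ≠ n → a j = 0 := fun j h0 h => by
    have hj0 : 0 < (j : ℕ) := Nat.pos_of_ne_zero fun h' => h0 (Fin.ext h')
    have hjn : (j : ℕ) < n := lt_of_le_of_ne (Fin.is_le j) h
    refine eq_zero_of_abs_slack_eq_zero (by positivity) ?_ (hzero j (by simpa using h0))
    rw [div_lt_one (by positivity)]
    gcongr
  have han : a (Fin.last n) = -(1 / (3 * (n : ℝ) ^ 2)) := by
    rw [sum_erase_zero_eq_last hn0 _ fun j h0 h => by rw [haj j h0 h, mul_zero],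
      Fin.val_last] at h2
    field_simp
    linarith
  rw [sum_erase_zero_eq_last hn0 _ haj, han] at h1
  ext j
  by_cases h0 : j = 0
  · rw [h0, hs0]
    linear_combination h1
  by_cases h : (j : ℕ) = n
  · rw [show j = Fin.last n from Fin.ext h, hsn, han]
  · rw [haj j h0 h, hsj j h0 h]
end

section
/- Let n ≥ 2 and let G_n be the Goodman–Sharma operator. If f : [0,1] → ℝ is continuous and convex on [0,1], then G_n f is convex on [0,1]. -/
open Polynomial intervalIntegral

/-- The Goodman–Sharma operator
`G_n f = Lf + (n−1) Σ_{i=1}^{n−1} ⟨f − Lf, b_{i−1}^{(n−2)}⟩ b_i^{(n)}`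
where `Lf(x) = (1−x)f(0) + x f(1)` and `⟨f,g⟩ = ∫₀¹ f g`. -/
noncomputable def goodmanSharma (n : ℕ) (f : ℝ → ℝ) (x : ℝ) : ℝ :=
  ((1 - x) * f 0 + x * f 1) +
    ((n : ℝ) - 1) *
      ∑ i ∈ Finset.Icc 1 (n - 1),
        (∫ t in (0 : ℝ)..1,
            (f t - ((1 - t) * f 0 + t * f 1)) *
              (bernsteinPolynomial ℝ (n - 2) (i - 1)).eval t) *
          (bernsteinPolynomial ℝ n i).eval x

theorem bernsteinPolynomial_eval_nonneg (n k : ℕ) {x : ℝ} (hx : x ∈ Set.Icc (0 : ℝ) 1) :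
    0 ≤ (bernsteinPolynomial ℝ n k).eval x := by
  have h0 := hx.1
  have h1 : 0 ≤ 1 - x := sub_nonneg.2 hx.2
  simp only [bernsteinPolynomial, eval_mul, eval_pow, eval_sub, eval_one, eval_X, eval_natCast]
  positivity

/-- The polynomial of degree at most `n` with Bernstein coefficients `a 0, …, a n`. -/
noncomputable def bernsteinSum (n : ℕ) (a : ℕ → ℝ) : ℝ[X] :=
  ∑ k ∈ Finset.range (n + 1), C (a k) * bernsteinPolynomial ℝ n k

theorem derivative_bernsteinSum (n : ℕ) (a : ℕ → ℝ) :
    derivative (bernsteinSum (n + 1) a) =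
      C (n + 1 : ℝ) * bernsteinSum n (fun k ↦ a (k + 1) - a k) := by
  have h1 := Finset.sum_range_succ (fun k ↦ C (a k) * bernsteinPolynomial ℝ n k) (n + 1)
  have h2 := Finset.sum_range_succ' (fun k ↦ C (a k) * bernsteinPolynomial ℝ n k) (n + 1)
  have h3 : bernsteinPolynomial ℝ n (n + 1) = 0 :=
    bernsteinPolynomial.eq_zero_of_lt ℝ (Nat.lt_succ_self n)
  simp only [bernsteinSum]
  rw [Finset.sum_range_succ', derivative_add, derivative_sum]
  simp only [derivative_C_mul, bernsteinPolynomial.derivative_succ,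
    bernsteinPolynomial.derivative_zero, Nat.add_sub_cancel, C_sub, sub_mul,
    Finset.sum_sub_distrib, mul_sub, mul_left_comm (C _) ((n + 1 : ℕ) : ℝ[X]), ← Finset.mul_sum]
  rw [h3] at h1
  simp only [C_add, C_1, map_natCast, Nat.cast_add, Nat.cast_one]
  linear_combination ((n : ℝ[X]) + 1) * (h2 - h1)

theorem derivative_derivative_bernsteinSum_eval_nonneg (n : ℕ) (a : ℕ → ℝ)
    (ha : ∀ k, k + 2 ≤ n → 0 ≤ a (k + 2) - 2 * a (k + 1) + a k)
    {x : ℝ} (hx : x ∈ Set.Icc (0 : ℝ) 1) :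
    0 ≤ (derivative (derivative (bernsteinSum n a))).eval x := by
  match n with
  | 0 => simp [bernsteinSum, bernsteinPolynomial]
  | 1 => rw [derivative_bernsteinSum]; simp [bernsteinSum, bernsteinPolynomial]
  | n + 2 =>
    rw [derivative_bernsteinSum, derivative_C_mul, derivative_bernsteinSum]
    simp only [bernsteinSum, eval_mul, eval_C, eval_finsetSum]
    refine mul_nonneg (by positivity) (mul_nonneg (by positivity) (Finset.sum_nonneg fun k hk ↦ ?_))
    have := ha k (by have := Finset.mem_range.1 hk; lia)
    exact mul_nonneg (by ring_nf at this ⊢; linarith) (bernsteinPolynomial_eval_nonneg n k hx)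

theorem bernsteinSum_eval_zero (n : ℕ) (a : ℕ → ℝ) : (bernsteinSum n a).eval 0 = a 0 := by
  simp [bernsteinSum, eval_finsetSum, bernsteinPolynomial.eval_at_0]

theorem bernsteinSum_eval_one (n : ℕ) (a : ℕ → ℝ) : (bernsteinSum n a).eval 1 = a n := by
  simp [bernsteinSum, eval_finsetSum, bernsteinPolynomial.eval_at_1]

theorem integral_eval_mul_eval_derivative_derivative (p q : ℝ[X])
    (hp0 : p.eval 0 = 0) (hp1 : p.eval 1 = 0) (hq0 : q.eval 0 = 0) (hq1 : q.eval 1 = 0) :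
    ∫ t in (0 : ℝ)..1, q.eval t * (derivative (derivative p)).eval t =
      ∫ t in (0 : ℝ)..1, (derivative (derivative q)).eval t * p.eval t := by
  rw [integral_mul_deriv_eq_deriv_mul (fun x _ ↦ q.hasDerivAt x)
      (fun x _ ↦ (derivative p).hasDerivAt x)
      ((Polynomial.continuous _).intervalIntegrable _ _)
      ((Polynomial.continuous _).intervalIntegrable _ _),
    integral_mul_deriv_eq_deriv_mul (fun x _ ↦ (derivative q).hasDerivAt x)
      (fun x _ ↦ p.hasDerivAt x)
      ((Polynomial.continuous _).intervalIntegrable _ _)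
      ((Polynomial.continuous _).intervalIntegrable _ _)]
  simp [hp0, hp1, hq0, hq1]

/-- If `g` is convex and vanishes at the endpoints of `[0,1]`, then the integral of `g` times the second derivative
of `p` is nonnegative, for each polynomial `p` which is nonnegative on `[0,1]` and vanishes at the endpoints. -/
theorem integral_mul_derivative_derivative_nonneg {g : ℝ → ℝ}
    (hg : ContinuousOn g (Set.Icc 0 1)) (hconv : ConvexOn ℝ (Set.Icc 0 1) g)
    (hg0 : g 0 = 0) (hg1 : g 1 = 0) {p : ℝ[X]}
    (hp : ∀ x ∈ Set.Icc (0 : ℝ) 1, 0 ≤ p.eval x) (hp0 : p.eval 0 = 0) (hp1 : p.eval 1 = 0) :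
    0 ≤ ∫ t in (0 : ℝ)..1, g t * (derivative (derivative p)).eval t := by
  let G : C(unitInterval, ℝ) := ⟨Set.domRestrict _ g, hg.domRestrict⟩
  let B : ℕ → ℝ[X] := fun m ↦ bernsteinSum m (fun k ↦ g (k / m))
  have hB : ∀ m : ℕ, ∀ t : unitInterval, (B m).eval (t : ℝ) = bernsteinApproximation m G t := by
    intro m t
    rw [bernsteinApproximation.apply]
    simp only [B, bernsteinSum, eval_finsetSum, Finset.sum_range, eval_mul, eval_C]
    refine Finset.sum_congr rfl fun k _ ↦ mul_comm _ _
  have hBpos : ∀ m : ℕ, m ≠ 0 →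
      0 ≤ ∫ t in (0 : ℝ)..1, (B m).eval t * (derivative (derivative p)).eval t := by
    intro m hm
    have hm' : (0 : ℝ) < m := by positivity
    rw [integral_eval_mul_eval_derivative_derivative p (B m) hp0 hp1
      (by simp [B, bernsteinSum_eval_zero, hg0]) (by simp [B, bernsteinSum_eval_one, hg1, hm])]
    refine integral_nonneg zero_le_one fun t ht ↦ mul_nonneg
      (derivative_derivative_bernsteinSum_eval_nonneg _ _ (fun k hk ↦ ?_) ht) (hp t ht)
    have hk' : (k : ℝ) + 2 ≤ m := by exact_mod_cast hk
    have := hconv.2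
      (show (k : ℝ) / m ∈ Set.Icc (0 : ℝ) 1 from
        ⟨by positivity, (div_le_one hm').2 (by linarith)⟩)
      (show ((k + 2 : ℕ) : ℝ) / m ∈ Set.Icc (0 : ℝ) 1 from
        ⟨by positivity, (div_le_one hm').2 (by push_cast; linarith)⟩)
      one_half_pos.le one_half_pos.le (add_halves 1)
    have hmid : (1 / 2 : ℝ) • ((k : ℝ) / m) + (1 / 2 : ℝ) • (((k + 2 : ℕ) : ℝ) / m) =
        ((k + 1 : ℕ) : ℝ) / m := by
      simp only [smul_eq_mul]; push_cast; field
    rw [hmid] at this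
    simp only [smul_eq_mul] at this
    linarith
  have hlim : Filter.Tendsto
      (fun m : ℕ ↦ ∫ t in (0 : ℝ)..1, (B m).eval t * (derivative (derivative p)).eval t)
      Filter.atTop (nhds (∫ t in (0 : ℝ)..1, g t * (derivative (derivative p)).eval t)) := by
    have hunif := bernsteinApproximation_uniform G
    have hF : Continuous fun φ : C(unitInterval, ℝ) ↦ ∫ t in (0 : ℝ)..1,
        φ (Set.projIcc 0 1 zero_le_one t) * (derivative (derivative p)).eval t := by
      refine continuous_parametric_intervalIntegral_of_continuous' ?_ 0 1
      fun_prop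
    have hproj : ∀ (φ : C(unitInterval, ℝ)) (h : ℝ → ℝ), (∀ t : unitInterval, h t = φ t) →
        ∫ t in (0 : ℝ)..1, φ (Set.projIcc 0 1 zero_le_one t) * (derivative (derivative p)).eval t =
          ∫ t in (0 : ℝ)..1, h t * (derivative (derivative p)).eval t := by
      refine fun φ h hφ ↦ integral_congr fun t ht ↦ ?_
      rw [Set.uIcc_of_le zero_le_one] at ht
      simp only [Set.projIcc_of_mem zero_le_one ht, ← hφ]
    have := (hF.tendsto G).comp hunif
    rw [hproj G g fun _ ↦ rfl] at this
    exact this.congr fun m ↦ hproj _ _ (hB m)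
  exact ge_of_tendsto hlim ((Filter.eventually_ne_atTop 0).mono hBpos)

/-- The Bernstein coefficients of the Goodman–Sharma operator of a function vanishing at the
endpoints. -/
noncomputable def goodmanSharmaCoeff (n : ℕ) (g : ℝ → ℝ) : ℕ → ℝ
  | 0 => 0
  | k + 1 => (n + 1) * ∫ t in (0 : ℝ)..1, g t * (bernsteinPolynomial ℝ n k).eval t

theorem goodmanSharmaCoeff_second_difference_nonneg (n : ℕ) {g : ℝ → ℝ}
    (hg : ContinuousOn g (Set.Icc 0 1)) (hconv : ConvexOn ℝ (Set.Icc 0 1) g)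
    (hg0 : g 0 = 0) (hg1 : g 1 = 0) (k : ℕ) (hk : k ≤ n) :
    0 ≤ goodmanSharmaCoeff n g (k + 2) - 2 * goodmanSharmaCoeff n g (k + 1) +
      goodmanSharmaCoeff n g k := by
  have hpos := integral_mul_derivative_derivative_nonneg hg hconv hg0 hg1
    (p := bernsteinPolynomial ℝ (n + 2) (k + 1))
    (fun x hx ↦ bernsteinPolynomial_eval_nonneg _ _ hx)
    (by simp [bernsteinPolynomial.eval_at_0])
    (by rw [bernsteinPolynomial.eval_at_1, if_neg (by lia)])
  have h_integrable : ∀ q : ℝ[X],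
      IntervalIntegrable (fun t ↦ g t * q.eval t) MeasureTheory.volume 0 1 :=
    fun q ↦ ContinuousOn.intervalIntegrable <| by
      rw [Set.uIcc_of_le zero_le_one]
      exact hg.mul q.continuous.continuousOn
  let J : ℝ[X] →ₗ[ℝ] ℝ :=
    { toFun := fun q ↦ ∫ t in (0 : ℝ)..1, g t * q.eval t
      map_add' := fun q r ↦ by
        simp only [eval_add, mul_add]
        exact integral_add (h_integrable q) (h_integrable r)
      map_smul' := fun c q ↦ by
        simp only [eval_smul, smul_eq_mul, mul_left_comm _ c, RingHom.id_apply]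
        exact integral_const_mul _ _ }
  have hJ : ∀ q : ℝ[X], (∫ t in (0 : ℝ)..1, g t * q.eval t) = J q := fun _ ↦ rfl
  rw [hJ] at hpos
  have hn : (0 : ℝ) < n + 2 := by positivity
  refine nonneg_of_mul_nonneg_right (hpos.trans_eq ?_) hn
  cases k with
  | zero =>
    have hd : derivative (derivative (bernsteinPolynomial ℝ (n + 2) (0 + 1))) =
        ((n + 2) * (n + 1) : ℝ) •
          (bernsteinPolynomial ℝ n 1 - (2 : ℝ) • bernsteinPolynomial ℝ n 0) := by
      have h2 := bernsteinPolynomial.derivative_succ ℝ (n + 1) 0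
      rw [bernsteinPolynomial.derivative_succ, derivative_natCast_mul, derivative_sub,
        Nat.add_succ_sub_one, h2, bernsteinPolynomial.derivative_zero]
      simp only [smul_eq_C_mul, C_mul, C_add, map_natCast, map_ofNat, map_one,
        Nat.add_sub_cancel]
      push_cast
      ring
    rw [hd]
    simp only [goodmanSharmaCoeff, hJ, map_smul, map_sub, smul_eq_mul]
    ring
  | succ k =>
    have hd : derivative (derivative (bernsteinPolynomial ℝ (n + 2) (k + 1 + 1))) =
        ((n + 2) * (n + 1) : ℝ) • (bernsteinPolynomial ℝ n (k + 2) -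
          (2 : ℝ) • bernsteinPolynomial ℝ n (k + 1) + bernsteinPolynomial ℝ n k) := by
      rw [bernsteinPolynomial.derivative_succ, derivative_natCast_mul, derivative_sub,
        Nat.add_succ_sub_one, bernsteinPolynomial.derivative_succ,
        bernsteinPolynomial.derivative_succ]
      simp only [smul_eq_C_mul, C_mul, C_add, map_natCast, map_ofNat, map_one,
        Nat.add_sub_cancel]
      push_cast
      ring
    rw [hd]
    simp only [goodmanSharmaCoeff, hJ, map_smul, map_sub, map_add, smul_eq_mul]
    ring

theorem goodmanSharma_eq (n : ℕ) (f : ℝ → ℝ) (x : ℝ) :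
    goodmanSharma (n + 2) f x = ((1 - x) * f 0 + x * f 1) + (bernsteinSum (n + 2)
      (goodmanSharmaCoeff n fun t ↦ f t - ((1 - t) * f 0 + t * f 1))).eval x := by
  have hlast : bernsteinPolynomial ℝ n (n + 1) = 0 :=
    bernsteinPolynomial.eq_zero_of_lt ℝ (Nat.lt_succ_self n)
  rw [goodmanSharma, bernsteinSum, eval_finsetSum, Finset.sum_range_succ, Finset.sum_range_succ']
  simp only [goodmanSharmaCoeff, hlast, eval_mul, eval_C, eval_zero, mul_zero, zero_mul,
    integral_zero, add_zero]
  rw [Finset.mul_sum, ← Finset.Ico_add_one_right_eq_Icc, Finset.sum_Ico_eq_sum_range]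
  congr 1
  refine Finset.sum_congr (by congr 1) fun k _ ↦ ?_
  simp only [add_comm 1 k, Nat.add_sub_cancel]
  push_cast
  ring

theorem Polynomial.convexOn_of_derivative_derivative_nonneg (p : ℝ[X]) {s : Set ℝ}
    (hs : Convex ℝ s) (h : ∀ x ∈ s, 0 ≤ (derivative (derivative p)).eval x) :
    ConvexOn ℝ s fun x ↦ p.eval x := by
  have hd : ∀ q : ℝ[X], deriv (fun x ↦ q.eval x) = fun x ↦ (derivative q).eval x :=
    fun q ↦ _root_.funext fun _ ↦ q.deriv
  refine convexOn_of_deriv2_nonneg' hs p.differentiableOn ?_ fun x hx ↦ ?_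
  · rw [hd]
    exact (derivative p).differentiableOn
  · rw [Function.iterate_succ_apply, Function.iterate_one, hd, hd]
    exact h x hx

/-- **The Goodman–Sharma operator preserves convexity.**  For `n ≥ 2`, if
`f` is continuous and convex on `[0,1]`, then `G_n f` is convex on `[0,1]`. -/
theorem goodmanSharma_preserves_convexity (n : ℕ) (hn : 2 ≤ n) (f : ℝ → ℝ)
    (hf : ContinuousOn f (Set.Icc 0 1)) (hconv : ConvexOn ℝ (Set.Icc 0 1) f) :
    ConvexOn ℝ (Set.Icc 0 1) (goodmanSharma n f) := by
  obtain ⟨n, rfl⟩ := Nat.exists_eq_add_of_le' hn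
  have haff : ∀ a b : ℝ, ConvexOn ℝ (Set.Icc 0 1) fun t : ℝ ↦ (1 - t) * a + t * b :=
    fun a b ↦ ⟨convex_Icc 0 1, fun x _ y _ c d _ _ hcd ↦ by
      obtain rfl := eq_sub_of_add_eq hcd
      simp only [smul_eq_mul]
      exact le_of_eq (by ring)⟩
  have hg : ConvexOn ℝ (Set.Icc 0 1) fun t ↦ f t - ((1 - t) * f 0 + t * f 1) := by
    refine (hconv.add (haff (-f 0) (-f 1))).congr fun t _ ↦ ?_
    simp only [Pi.add_apply]
    ring
  have hfun := funext (goodmanSharma_eq n f)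
  rw [hfun]
  refine (haff _ _).add (Polynomial.convexOn_of_derivative_derivative_nonneg _ (convex_Icc 0 1)
    fun x hx ↦ derivative_derivative_bernsteinSum_eval_nonneg _ _ (fun k hk ↦
      goodmanSharmaCoeff_second_difference_nonneg n (hf.sub (by fun_prop)) hg (by simp) (by simp)
        k (by lia)) hx)
end
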